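/- For all n ≥ 2, the number of permutations π ∈ S_n with θ²(π) = π that avoid the pattern 321 is f_n^2(321) = F_{n+1}. -/

import Mathlib

/-- The one-line word of the image of `π` under the fundamental bijection:
write `π` in standard cycle form (every cycle written with its largest element
first, cycles listed in increasing order of their largest elements) and erase
the parentheses.  The cycle maxima are exactly the `x` with `π^[k] x ≤ x` for
all `k`, and the cycle of `x` is `x, π x, π² x, …` up to the period of `x`. -/
noncomputable def fundWord {n : ℕ} (π : Equiv.Perm (Fin n)) : List (Fin n) :=
  ((List.finRange n).filter fun x => (List.range n).all fun k => decide ((⇑π)^[k] x ≤ x)).flatMap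
    fun x => (List.range (Function.minimalPeriod (⇑π) x)).map fun k => (⇑π)^[k] x

/-- The permutation whose one-line notation is the word `w`
(junk value if `w` is not the one-line notation of a permutation). -/
noncomputable def permOfWord {n : ℕ} (w : List (Fin n)) : Equiv.Perm (Fin n) :=
  Function.invFun (fun σ : Equiv.Perm (Fin n) => (List.finRange n).map ⇑σ) w

/-- The fundamental bijection `θ`. -/
noncomputable def theta {n : ℕ} (π : Equiv.Perm (Fin n)) : Equiv.Perm (Fin n) :=
  permOfWord (fundWord π)

/-- `π` contains the pattern `σ`. -/
def Contains {k n : ℕ} (σ : Equiv.Perm (Fin k)) (π : Equiv.Perm (Fin n)) : Prop :=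
  ∃ f : Fin k → Fin n, StrictMono f ∧ ∀ a b : Fin k, π (f a) < π (f b) ↔ σ a < σ b

/-- `π` avoids the pattern `σ`. -/
def Avoids {k n : ℕ} (π : Equiv.Perm (Fin n)) (σ : Equiv.Perm (Fin k)) : Prop :=
  ¬ Contains σ π

noncomputable def p123 : Equiv.Perm (Fin 3) := Equiv.ofBijective ![0, 1, 2] (by decide)
noncomputable def p132 : Equiv.Perm (Fin 3) := Equiv.ofBijective ![0, 2, 1] (by decide)
noncomputable def p213 : Equiv.Perm (Fin 3) := Equiv.ofBijective ![1, 0, 2] (by decide)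
noncomputable def p231 : Equiv.Perm (Fin 3) := Equiv.ofBijective ![1, 2, 0] (by decide)
noncomputable def p312 : Equiv.Perm (Fin 3) := Equiv.ofBijective ![2, 0, 1] (by decide)
noncomputable def p321 : Equiv.Perm (Fin 3) := Equiv.ofBijective ![2, 1, 0] (by decide)

/-- The direct sum `π ⊕ τ` of two permutations. -/
def directSum {n m : ℕ} (π : Equiv.Perm (Fin n)) (τ : Equiv.Perm (Fin m)) :
    Equiv.Perm (Fin (n + m)) :=
  finSumFinEquiv.permCongr (Equiv.sumCongr π τ)

/-- A permutation is irreducible if it is not a direct sum of two nonempty permutations. -/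
def IrreduciblePerm {n : ℕ} (π : Equiv.Perm (Fin n)) : Prop :=
  ¬ ∃ (a b : ℕ) (_ : 0 < a) (_ : 0 < b) (h : a + b = n)
      (σ : Equiv.Perm (Fin a)) (τ : Equiv.Perm (Fin b)),
      π = (finCongr h).permCongr (directSum σ τ)

/-- A permutation is cyclic if its cycle decomposition is a single cycle of full length,
i.e. it acts transitively. -/
def IsCyclicPerm {n : ℕ} (π : Equiv.Perm (Fin n)) : Prop :=
  ∀ x y : Fin n, ∃ k : ℕ, (⇑π)^[k] x = y

section FundamentalBijection

variable {n : ℕ} (π : Equiv.Perm (Fin n))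

/-- The largest elements of the cycles of `π`, in increasing order. -/
def cycleMaxima : List (Fin n) :=
  (List.finRange n).filter fun x => (List.range n).all fun k => decide ((⇑π)^[k] x ≤ x)

/-- The cycle of `π` written from `x` on. -/
noncomputable def cycleWord (x : Fin n) : List (Fin n) :=
  (List.range (Function.minimalPeriod (⇑π) x)).map fun k => (⇑π)^[k] x

theorem fundWord_eq_flatMap : fundWord π = (cycleMaxima π).flatMap (cycleWord π) := rfl

theorem mem_periodicPts (x : Fin n) : x ∈ Function.periodicPts π :=
  π.injective.mem_periodicPts x

theorem minimalPeriod_pos (x : Fin n) : 0 < Function.minimalPeriod π x :=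
  Function.minimalPeriod_pos_of_mem_periodicPts (mem_periodicPts π x)

theorem minimalPeriod_le (x : Fin n) : Function.minimalPeriod π x ≤ n := by
  by_contra! h
  obtain ⟨i, j, hij, he⟩ := Fintype.exists_ne_map_eq_of_card_lt
    (fun k : Fin (Function.minimalPeriod π x) => (⇑π)^[k] x) (by simpa using h)
  exact hij (Fin.ext (Function.iterate_injOn_Iio_minimalPeriod i.2 j.2 he))

theorem exists_lt_minimalPeriod (x : Fin n) (k : ℕ) :
    ∃ j < Function.minimalPeriod π x, (⇑π)^[j] x = (⇑π)^[k] x :=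
  ⟨k % _, Nat.mod_lt _ (minimalPeriod_pos π x), Function.iterate_mod_minimalPeriod_eq⟩

theorem exists_iterate_iterate_eq (x : Fin n) (k : ℕ) : ∃ j, (⇑π)^[j] ((⇑π)^[k] x) = x := by
  have hp := minimalPeriod_pos π x
  refine ⟨Function.minimalPeriod π x * k - k, ?_⟩
  rw [← Function.iterate_add_apply, Nat.sub_add_cancel (Nat.le_mul_of_pos_left k hp)]
  exact (Function.isPeriodicPt_minimalPeriod π x).mul_const k

theorem mem_cycleMaxima {x : Fin n} : x ∈ cycleMaxima π ↔ ∀ k, (⇑π)^[k] x ≤ x := by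
  simp only [cycleMaxima, List.mem_filter, List.mem_finRange, true_and, List.all_eq_true,
    List.mem_range, decide_eq_true_eq]
  refine ⟨fun h k => ?_, fun h k _ => h k⟩
  obtain ⟨j, hj, he⟩ := exists_lt_minimalPeriod π x k
  exact he ▸ h j (hj.trans_le (minimalPeriod_le π x))

theorem mem_cycleWord {x y : Fin n} : y ∈ cycleWord π x ↔ ∃ k, (⇑π)^[k] x = y := by
  simp only [cycleWord, List.mem_map, List.mem_range]
  refine ⟨fun ⟨k, _, h⟩ => ⟨k, h⟩, fun ⟨k, h⟩ => ?_⟩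
  exact h ▸ exists_lt_minimalPeriod π x k

theorem mem_cycleWord_symm {x y : Fin n} (h : y ∈ cycleWord π x) : x ∈ cycleWord π y := by
  obtain ⟨k, rfl⟩ := (mem_cycleWord π).1 h
  exact (mem_cycleWord π).2 (exists_iterate_iterate_eq π x k)

theorem mem_cycleWord_trans {x y z : Fin n} (h : y ∈ cycleWord π x) (h' : z ∈ cycleWord π y) :
    z ∈ cycleWord π x := by
  obtain ⟨k, rfl⟩ := (mem_cycleWord π).1 h
  obtain ⟨l, rfl⟩ := (mem_cycleWord π).1 h'
  exact (mem_cycleWord π).2 ⟨l + k, Function.iterate_add_apply _ _ _ _⟩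

theorem le_of_mem_cycleWord {x y : Fin n} (hx : x ∈ cycleMaxima π) (h : y ∈ cycleWord π x) :
    y ≤ x := by
  obtain ⟨k, rfl⟩ := (mem_cycleWord π).1 h
  exact (mem_cycleMaxima π).1 hx k

theorem nodup_cycleWord (x : Fin n) : (cycleWord π x).Nodup :=
  List.nodup_range.map_on fun _ ha _ hb h =>
    Function.iterate_injOn_Iio_minimalPeriod (List.mem_range.1 ha) (List.mem_range.1 hb) h

theorem sorted_cycleMaxima : (cycleMaxima π).Pairwise (· < ·) :=
  (List.pairwise_lt_finRange n).filter _

theorem nodup_fundWord : (fundWord π).Nodup := by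
  rw [fundWord_eq_flatMap, List.nodup_flatMap]
  refine ⟨fun x _ => nodup_cycleWord π x, ?_⟩
  refine (sorted_cycleMaxima π).imp_of_mem ?_
  intro x y hx hy hxy z hzx hzy
  have h := mem_cycleWord_trans π hzx (mem_cycleWord_symm π hzy)
  exact absurd (le_of_mem_cycleWord π hx h) (not_le.2 hxy)

theorem exists_mem_cycleMaxima (y : Fin n) : ∃ x ∈ cycleMaxima π, y ∈ cycleWord π x := by
  obtain ⟨x, hx, hmax⟩ := (cycleWord π y).toFinset.exists_max_image id
    ⟨y, by simpa using (mem_cycleWord π).2 ⟨0, rfl⟩⟩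
  simp only [List.mem_toFinset, id] at hx hmax
  refine ⟨x, (mem_cycleMaxima π).2 fun k => hmax _ ?_, mem_cycleWord_symm π hx⟩
  exact mem_cycleWord_trans π hx ((mem_cycleWord π).2 ⟨k, rfl⟩)

theorem mem_fundWord (y : Fin n) : y ∈ fundWord π := by
  rw [fundWord_eq_flatMap, List.mem_flatMap]
  exact exists_mem_cycleMaxima π y

theorem length_fundWord : (fundWord π).length = n := by
  rw [← List.toFinset_card_of_nodup (nodup_fundWord π),
    Finset.eq_univ_of_forall fun y => List.mem_toFinset.2 (mem_fundWord π y), Finset.card_fin]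

theorem map_theta : (List.finRange n).map (theta π) = fundWord π := by
  have hlen := length_fundWord π
  let f : Fin n → Fin n := fun i => (fundWord π)[i]'(by omega)
  have hf : Function.Injective f := fun i j h =>
    Fin.ext ((nodup_fundWord π).getElem_inj_iff.1 h)
  refine Function.invFun_eq (f := fun σ : Equiv.Perm (Fin n) => (List.finRange n).map ⇑σ)
    ⟨Equiv.ofBijective f (Finite.injective_iff_bijective.1 hf), ?_⟩
  refine List.ext_getElem (by simp [hlen]) fun i h₁ h₂ => ?_
  simp [f]

theorem getElem_fundWord (i : Fin n) :
    (fundWord π)[(i : ℕ)]'((length_fundWord π).symm ▸ i.2) = theta π i := by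
  simp [← map_theta π]

/-- Within a cycle, `θ(π)` runs through the orbit of `π`. -/
theorem theta_succ {i : Fin n} (h : π (theta π i) ∉ cycleMaxima π) :
    ∃ j : Fin n, (j : ℕ) = i + 1 ∧ theta π j = π (theta π i) := by
  obtain ⟨x, hx, hy⟩ := exists_mem_cycleMaxima π (theta π i)
  obtain ⟨s, t, hst⟩ := List.append_of_mem hx
  obtain ⟨k, hk, hky⟩ := List.mem_map.1 hy
  rw [List.mem_range] at hk
  have hk' : k + 1 < Function.minimalPeriod π x := by
    refine lt_of_le_of_ne hk fun he => h ?_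
    rw [← hky, ← Function.iterate_succ_apply' (⇑π), Nat.succ_eq_add_one, he,
      Function.iterate_minimalPeriod]
    exact hx
  have hw : fundWord π = s.flatMap (cycleWord π) ++ (cycleWord π x ++ t.flatMap (cycleWord π)) := by
    rw [fundWord_eq_flatMap, hst, List.flatMap_append, List.flatMap_cons]
  set a := (s.flatMap (cycleWord π)).length with ha
  have hl : (cycleWord π x).length = Function.minimalPeriod π x := by simp [cycleWord]
  have hlen : a + Function.minimalPeriod π x ≤ n := by
    have := congrArg List.length hw
    rw [length_fundWord, List.length_append, List.length_append, hl] at this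
    omega
  have key : ∀ l (hl' : l < Function.minimalPeriod π x),
      theta π ⟨a + l, by omega⟩ = (⇑π)^[l] x := by
    intro l hl'
    rw [← getElem_fundWord]
    simp only [hw]
    rw [List.getElem_append_right (by simp [← ha]), List.getElem_append_left (by simp [← ha, hl, hl'])]
    simp [cycleWord, ← ha]
  have hi : i = ⟨a + k, by omega⟩ := (theta π).injective (by rw [key k hk, hky])
  refine ⟨⟨a + (k + 1), by omega⟩, by simp [hi, add_assoc], ?_⟩
  rw [key _ hk', Function.iterate_succ_apply', hky]

/-- If `π` preserves an initial segment, then `θ(π)` ends it with the preimage of its maximum. -/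
theorem apply_theta_of_forall_le {M : Fin n} (h : ∀ i ≤ M, π i ≤ M) : π (theta π M) = M := by
  have hit : ∀ i ≤ M, ∀ k, (⇑π)^[k] i ≤ M := fun i hi k => by
    induction k with
    | zero => exact hi
    | succ k ih => rw [Function.iterate_succ_apply']; exact h _ ih
  have hM : M ∈ cycleMaxima π := (mem_cycleMaxima π).2 (hit M le_rfl)
  obtain ⟨s, t, hst⟩ := List.append_of_mem hM
  have hsort := sorted_cycleMaxima π
  rw [hst, List.pairwise_append, List.pairwise_cons] at hsort
  obtain ⟨-, ⟨ht, -⟩, hs⟩ := hsort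
  set u := s.flatMap (cycleWord π) ++ cycleWord π M with hu
  have hw : fundWord π = u ++ t.flatMap (cycleWord π) := by
    rw [fundWord_eq_flatMap, hst, List.flatMap_append, List.flatMap_cons, hu, List.append_assoc]
  have hmem : ∀ y, y ∈ u ↔ y ≤ M := by
    intro y
    constructor
    · intro hy
      rcases List.mem_append.1 hy with hy | hy
      · obtain ⟨x, hx, hyx⟩ := List.mem_flatMap.1 hy
        exact (le_of_mem_cycleWord π (by rw [hst]; simp [hx]) hyx).trans
          (hs x hx M (by simp)).le
      · exact le_of_mem_cycleWord π hM hy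
    · intro hy
      have := mem_fundWord π y
      rw [hw, List.mem_append] at this
      refine this.resolve_right fun hyt => ?_
      obtain ⟨x, hx, hyx⟩ := List.mem_flatMap.1 hyt
      obtain ⟨k, hk⟩ := (mem_cycleWord π).1 (mem_cycleWord_symm π hyx)
      exact absurd (hk ▸ hit y hy k) (not_le.2 (ht x hx))
  have hlen : u.length = M + 1 := by
    have hnd : u.Nodup := (hw ▸ nodup_fundWord π).of_append_left
    rw [← List.toFinset_card_of_nodup hnd, ← Fin.card_Iic]
    congr 1
    ext y
    simp [hmem]
  have hp := minimalPeriod_pos π M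
  have hl : (cycleWord π M).length = Function.minimalPeriod π M := by simp [cycleWord]
  have hlen' : (s.flatMap (cycleWord π)).length + Function.minimalPeriod π M = M + 1 := by
    rw [← hlen, hu, List.length_append, hl]
  have hval : theta π M = (⇑π)^[Function.minimalPeriod π M - 1] M := by
    rw [← getElem_fundWord]
    simp only [hw]
    rw [List.getElem_append_left (by omega)]
    simp only [hu]
    rw [List.getElem_append_right (by omega)]
    simp only [cycleWord, List.getElem_map, List.getElem_range]
    congr 1
    omega
  rw [hval, ← Function.iterate_succ_apply' (⇑π), Nat.succ_eq_add_one, Nat.sub_add_cancel hp,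
    Function.iterate_minimalPeriod]

end FundamentalBijection

theorem notMem_cycleMaxima_of_lt {n : ℕ} {π : Equiv.Perm (Fin n)} {x y : Fin n} (h : π x = y)
    (hlt : x < y) : x ∉ cycleMaxima π := fun hx =>
  absurd ((mem_cycleMaxima π).1 hx 1) (not_le.2 (by simpa [h] using hlt))

/-- `π` is an involution moving every point by at most one place; equivalently, a direct sum of
copies of `1` and `21`. -/
def IsShortInvolution {n : ℕ} (π : Equiv.Perm (Fin n)) : Prop :=
  ∀ i, π (π i) = i ∧ (π i : ℕ) ≤ i + 1

namespace IsShortInvolution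

variable {n : ℕ} {π : Equiv.Perm (Fin n)}

theorem le_apply_add_one (h : IsShortInvolution π) (i : Fin n) : (i : ℕ) ≤ π i + 1 := by
  simpa [(h i).1] using (h (π i)).2

theorem avoids (h : IsShortInvolution π) : Avoids π p321 := by
  rintro ⟨f, hf, hp⟩
  have h01 : f 0 < f 1 := hf (by decide)
  have h12 : f 1 < f 2 := hf (by decide)
  have h10 : π (f 1) < π (f 0) := (hp 1 0).2 (by simp [p321])
  have h21 : π (f 2) < π (f 1) := (hp 2 1).2 (by simp [p321])
  have := (h (f 0)).2
  have := h.le_apply_add_one (f 2)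
  omega

theorem theta_eq_of_apply_le (h : IsShortInvolution π) {i : Fin n} (hi : π i ≤ i) :
    theta π i = π i := by
  have key : π (theta π i) = i := by
    refine apply_theta_of_forall_le π fun j hj => ?_
    have hj' := (h j).2
    by_contra! hlt
    have hji : j = i := by omega
    subst hji
    omega
  rw [← (h (theta π i)).1, key]

theorem theta_eq (h : IsShortInvolution π) : theta π = π := by
  ext1 i
  rcases le_or_gt (π i) i with hi | hi
  · exact h.theta_eq_of_apply_le hi
  · have h1 : (π i : ℕ) = i + 1 := by have := (h i).2; omega
    have h2 : theta π (π i) = i := by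
      rw [h.theta_eq_of_apply_le (by rw [(h i).1]; exact hi.le), (h i).1]
    obtain ⟨j, hj⟩ := (theta π).surjective (π i)
    obtain ⟨l, hl, hl'⟩ := theta_succ π (i := j)
      (by rw [hj, (h i).1]; exact notMem_cycleMaxima_of_lt rfl hi)
    rw [hj, (h i).1] at hl'
    have : l = π i := (theta π).injective (hl'.trans h2.symm)
    have hji : j = i := by subst this; omega
    rw [← hji, hj, hji]

end IsShortInvolution

/-- The local analysis at the top of a common invariant initial segment. -/
theorem top_of_theta_theta_eq {n : ℕ} {π : Equiv.Perm (Fin n)} (hθ : theta (theta π) = π)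
    (hav : Avoids π p321) {M : Fin n} (hπ : ∀ i ≤ M, π i ≤ M) (hσ : ∀ i ≤ M, theta π i ≤ M) :
    (π M = M ∧ theta π M = M) ∨
      ∃ a : Fin n, (M : ℕ) = a + 1 ∧ π M = a ∧ π a = M ∧ theta π M = a ∧ theta π a = M := by
  have h1 : π (theta π M) = M := apply_theta_of_forall_le π hπ
  have h2 : theta π (π M) = M := by simpa [hθ] using apply_theta_of_forall_le (theta π) hσ
  rcases (hπ M le_rfl).eq_or_lt with hM | hM
  · exact Or.inl ⟨hM, by rw [hM] at h2; exact h2⟩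
  · right
    set a := π M with ha
    obtain ⟨b, hb, hb'⟩ := theta_succ π (i := a) (by
      rw [h2, ← ha]
      intro hmax
      have : M ∈ cycleWord π a :=
        mem_cycleWord_symm π ((mem_cycleWord π).2 ⟨1, ha.symm⟩)
      exact absurd (le_of_mem_cycleWord π hmax this) (not_le.2 hM))
    rw [h2, ← ha] at hb'
    by_cases hbM : b = M
    · subst hbM
      exact ⟨a, hb, rfl, by rw [← hb', h1], hb', h2⟩
    · exfalso
      obtain ⟨i, hi⟩ := π.surjective b
      have hs := theta_succ (theta π) (i := i)
      rw [hθ, hi, hb'] at hs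
      obtain ⟨j, hj, hj'⟩ := hs (notMem_cycleMaxima_of_lt h2 hM)
      have hjM : j = M := π.injective (hj'.trans ha)
      subst hjM
      obtain ⟨m, hm, hmj⟩ : ∃ m, π m = j ∧ m ≤ j := ⟨theta π j, h1, hσ j le_rfl⟩
      have hne1 : m ≠ j := by rintro rfl; exact absurd (ha.trans hm) hM.ne
      have hne2 : m ≠ i := by rintro rfl; exact hbM (hi.symm.trans hm)
      refine hav ⟨![m, i, j], ?_, ?_⟩
      · intro x y hxy
        fin_cases x <;> fin_cases y <;> simp at hxy ⊢ <;> omega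
      · intro x y
        fin_cases x <;> fin_cases y <;> simp [p321, hm, hi, ← ha] <;> omega

theorem isShortInvolution_of_theta_theta_eq {n : ℕ} {π : Equiv.Perm (Fin n)}
    (hθ : theta (theta π) = π) (hav : Avoids π p321) : IsShortInvolution π := by
  suffices H : ∀ k, (∀ i : Fin n, (i : ℕ) < k → (π i : ℕ) < k ∧ (theta π i : ℕ) < k) →
      ∀ i : Fin n, (i : ℕ) < k → π (π i) = i ∧ (π i : ℕ) ≤ i + 1 from
    fun i => H n (fun j _ => ⟨(π j).2, (theta π j).2⟩) i i.2
  intro k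
  induction k using Nat.strong_induction_on with
  | _ k ih =>
    intro hk i hi
    by_cases hkn : k ≤ n
    swap
    · exact ih n (by omega) (fun j _ => ⟨(π j).2, (theta π j).2⟩) i i.2
    obtain ⟨M, hMk⟩ : ∃ M : Fin n, (M : ℕ) + 1 = k := ⟨⟨k - 1, by omega⟩, by simp; omega⟩
    have hle : ∀ j : Fin n, j ≤ M ↔ (j : ℕ) < k := fun j => by
      rw [Fin.le_def]; omega
    rcases top_of_theta_theta_eq hθ hav (M := M)
      (fun j hj => (hle _).2 (hk j ((hle j).1 hj)).1)
      (fun j hj => (hle _).2 (hk j ((hle j).1 hj)).2) with ⟨h1, h2⟩ | ⟨a, haM, h1, h2, h3, h4⟩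
    · rcases eq_or_ne i M with rfl | hne
      · rw [h1, h1]; simp
      · have hne' : (i : ℕ) ≠ M := fun h => hne (Fin.ext h)
        refine ih (k - 1) (by omega) (fun j hj => ?_) i (by omega)
        have hj' : j ≠ M := by rintro rfl; omega
        have e1 : (π j : ℕ) ≠ M := fun h => hj' (π.injective ((Fin.ext h).trans h1.symm))
        have e2 : (theta π j : ℕ) ≠ M :=
          fun h => hj' ((theta π).injective ((Fin.ext h).trans h2.symm))
        have := hk j (by omega)
        omega
    · rcases eq_or_ne i M with rfl | hne
      · rw [h1, h2]; exact ⟨rfl, by omega⟩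
      rcases eq_or_ne i a with rfl | hne2
      · rw [h2, h1]; exact ⟨rfl, by omega⟩
      · have hne' : (i : ℕ) ≠ M := fun h => hne (Fin.ext h)
        have hne2' : (i : ℕ) ≠ a := fun h => hne2 (Fin.ext h)
        refine ih (k - 2) (by omega) (fun j hj => ?_) i (by omega)
        have hjM : j ≠ M := by rintro rfl; omega
        have hja : j ≠ a := by rintro rfl; omega
        have e1 : (π j : ℕ) ≠ M := fun h => hja (π.injective ((Fin.ext h).trans h2.symm))
        have e2 : (theta π j : ℕ) ≠ M :=
          fun h => hja ((theta π).injective ((Fin.ext h).trans h4.symm))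
        have e3 : (π j : ℕ) ≠ a := fun h => hjM (π.injective ((Fin.ext h).trans h1.symm))
        have e4 : (theta π j : ℕ) ≠ a :=
          fun h => hjM ((theta π).injective ((Fin.ext h).trans h3.symm))
        have := hk j (by omega)
        omega

theorem theta_theta_eq_and_avoids_iff {n : ℕ} {π : Equiv.Perm (Fin n)} :
    theta (theta π) = π ∧ Avoids π p321 ↔ IsShortInvolution π :=
  ⟨fun h => isShortInvolution_of_theta_theta_eq h.1 h.2,
    fun h => ⟨by rw [h.theta_eq, h.theta_eq], h.avoids⟩⟩

/-- The involutions of `ℕ` moving points by at most one place and fixing every `i ≥ n`. -/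
def shortInvolutions (n : ℕ) : Set (ℕ → ℕ) :=
  {f | (∀ i, f (f i) = i ∧ f i ≤ i + 1) ∧ ∀ i, n ≤ i → f i = i}

theorem lt_of_mem_shortInvolutions {n : ℕ} {f : ℕ → ℕ} (hf : f ∈ shortInvolutions n) {i : ℕ}
    (hi : i < n) : f i < n := by
  by_contra! h
  have := hf.2 _ h
  have := (hf.1 i).1
  omega

/-- Extension by the identity identifies short involutions of `Fin n` with those of `ℕ` fixing
every `i ≥ n`. -/
def shortInvolutionEquiv (n : ℕ) :
    {π : Equiv.Perm (Fin n) // IsShortInvolution π} ≃ shortInvolutions n where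
  toFun π := ⟨fun i => if h : i < n then π.1 ⟨i, h⟩ else i, by
    constructor
    · intro i
      by_cases h : i < n
      · simpa [h, Fin.ext_iff] using π.2 ⟨i, h⟩
      · simp [h]
    · intro i h
      simp [not_lt.2 h]⟩
  invFun f := ⟨⟨fun i => ⟨f.1 i, lt_of_mem_shortInvolutions f.2 i.2⟩,
      fun i => ⟨f.1 i, lt_of_mem_shortInvolutions f.2 i.2⟩,
      fun i => Fin.ext (f.2.1 i).1, fun i => Fin.ext (f.2.1 i).1⟩,
    fun i => ⟨Fin.ext (f.2.1 i).1, (f.2.1 i).2⟩⟩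
  left_inv π := by
    ext i
    simp
  right_inv f := by
    ext i
    by_cases h : i < n
    · simp [h]
    · simp [h, f.2.2 i (not_lt.1 h)]

theorem shortInvolutions_zero : shortInvolutions 0 = {id} := by
  ext f
  constructor
  · exact fun h => funext fun i => h.2 i (Nat.zero_le i)
  · rintro rfl
    simp [shortInvolutions]

theorem shortInvolutions_one : shortInvolutions 1 = {id} := by
  ext f
  constructor
  · intro h
    funext i
    rcases Nat.eq_zero_or_pos i with rfl | hi
    · simpa using lt_of_mem_shortInvolutions h Nat.one_pos
    · exact h.2 i hi
  · rintro rfl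
    simp [shortInvolutions]

theorem shortInvolutions_add_two (n : ℕ) :
    shortInvolutions (n + 2) =
      shortInvolutions (n + 1) ∪ (· ∘ Equiv.swap n (n + 1)) '' shortInvolutions n := by
  ext f
  constructor
  · intro h
    by_cases hf : f (n + 1) = n + 1
    · refine Or.inl ⟨h.1, fun i hi => ?_⟩
      rcases hi.eq_or_lt with rfl | hi
      · exact hf
      · exact h.2 i hi
    · have hlt := lt_of_mem_shortInvolutions h (Nat.lt_succ_self (n + 1))
      have hle := (h.1 (f (n + 1))).2
      rw [(h.1 _).1] at hle
      have h1 : f (n + 1) = n := by omega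
      have h0 : f n = n + 1 := by rw [← h1, (h.1 _).1, h1]
      have hne : ∀ i, i ≠ n → i ≠ n + 1 → f i ≠ n ∧ f i ≠ n + 1 := fun i hi hi' =>
        ⟨fun e => hi' (by rw [← (h.1 i).1, e, h0]), fun e => hi (by rw [← (h.1 i).1, e, h1])⟩
      refine Or.inr ⟨f ∘ Equiv.swap n (n + 1), ⟨fun i => ?_, fun i hi => ?_⟩, ?_⟩
      · rcases eq_or_ne i n with rfl | hi
        · simp [h1]
        rcases eq_or_ne i (n + 1) with rfl | hi'
        · simp [h0]
        · simpa [Equiv.swap_apply_of_ne_of_ne, hi, hi', hne i hi hi'] using h.1 i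
      · rcases eq_or_ne i n with rfl | hi₀
        · simp [h1]
        rcases eq_or_ne i (n + 1) with rfl | hi'
        · simp [h0]
        · simpa [Equiv.swap_apply_of_ne_of_ne, hi₀, hi'] using h.2 i (by omega)
      · ext i
        simp
  · rintro (h | ⟨f, h, rfl⟩)
    · exact ⟨h.1, fun i hi => h.2 i (by omega)⟩
    · have h0 := h.2 n le_rfl
      have h1 := h.2 (n + 1) (Nat.le_succ n)
      have hne : ∀ i, i ≠ n → i ≠ n + 1 → f i ≠ n ∧ f i ≠ n + 1 := fun i hi hi' =>
        ⟨fun e => hi (by rw [← (h.1 i).1, e, h0]), fun e => hi' (by rw [← (h.1 i).1, e, h1])⟩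
      refine ⟨fun i => ?_, fun i hi => ?_⟩
      · rcases eq_or_ne i n with rfl | hi
        · simp [h0, h1]
        rcases eq_or_ne i (n + 1) with rfl | hi'
        · simp [h0, h1, add_assoc]
        · simpa [Equiv.swap_apply_of_ne_of_ne, hi, hi', hne i hi hi'] using h.1 i
      · simpa [Equiv.swap_apply_of_ne_of_ne, show i ≠ n by omega, show i ≠ n + 1 by omega]
          using h.2 i (by omega)

theorem disjoint_shortInvolutions (n : ℕ) :
    Disjoint (shortInvolutions (n + 1)) ((· ∘ Equiv.swap n (n + 1)) '' shortInvolutions n) := by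
  rw [Set.disjoint_left]
  rintro _ h ⟨f, hf, rfl⟩
  have h1 := h.2 (n + 1) le_rfl
  have h2 := hf.2 n le_rfl
  simp only [Function.comp_apply, Equiv.swap_apply_right] at h1
  omega

theorem finite_and_ncard_shortInvolutions (n : ℕ) :
    (shortInvolutions n).Finite ∧ (shortInvolutions n).ncard = Nat.fib (n + 1) := by
  induction n using Nat.twoStepInduction with
  | zero => simp [shortInvolutions_zero]
  | one => simp [shortInvolutions_one]
  | more n ih₀ ih₁ =>
    have hinj : Function.Injective fun f : ℕ → ℕ => f ∘ Equiv.swap n (n + 1) :=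
      (Equiv.swap n (n + 1)).surjective.injective_comp_right
    rw [shortInvolutions_add_two]
    refine ⟨ih₁.1.union (ih₀.1.image _), ?_⟩
    rw [Set.ncard_union_eq (disjoint_shortInvolutions n) ih₁.1 (ih₀.1.image _),
      Set.ncard_image_of_injective _ hinj, ih₀.2, ih₁.2, Nat.fib_add_two (n := n + 1), add_comm]

/-- for `n ≥ 2`, the number of permutations with `θ²(π) = π` avoiding
`321` is `F_{n+1}`. -/
theorem f2_n_321 (n : ℕ) (hn : 2 ≤ n) :
    Nat.card {π : Equiv.Perm (Fin n) // theta (theta π) = π ∧ Avoids π p321} =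
      Nat.fib (n + 1) := by
  rw [Nat.card_congr (Equiv.subtypeEquivRight fun _ => theta_theta_eq_and_avoids_iff),
    Nat.card_congr (shortInvolutionEquiv n), Nat.card_coe_set_eq]
  exact (finite_and_ncard_shortInvolutions n).2
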